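/- arXiv:math/0404549 — 2 statements merged into one kernel-verified Lean document; each statement's English description precedes it below -/
import Mathlib

section
/- The kernel T = ker(ϖ) is a normal subgroup of Sp(k,ℓ) which, when endowed with the subspace topology inherited from the space of 2ℓ×2ℓ real matrices, is a contractible topological space (hence simply connected). -/
open Matrix

/-- Half index type: `Fin k ⊕ Fin m` with `m = ℓ - k`. -/
abbrev HalfIdx (k m : ℕ) := Fin k ⊕ Fin m

/-- Full index type for `2ℓ × 2ℓ` matrices, in block form `(k, m, k, m)`. -/
abbrev FullIdx (k m : ℕ) := HalfIdx k m ⊕ HalfIdx k m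

/-- The standard symplectic matrix `J = [[0, I], [-I, 0]]`. -/
def Jmat (k m : ℕ) : Matrix (FullIdx k m) (FullIdx k m) ℝ :=
  Matrix.fromBlocks 0 1 (-1) 0

/-- The symplectic group `Sp(ℓ)`: matrices with `Mᵀ J M = J`. -/
def SpBig (k m : ℕ) : Set (Matrix (FullIdx k m) (FullIdx k m) ℝ) :=
  {M | Mᵀ * Jmat k m * M = Jmat k m}

def Jsmall (m : ℕ) : Matrix (Fin m ⊕ Fin m) (Fin m ⊕ Fin m) ℝ :=
  Matrix.fromBlocks 0 1 (-1) 0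

/-- The symplectic group `Sp(ℓ-k)`. -/
def SpSmall (m : ℕ) : Set (Matrix (Fin m ⊕ Fin m) (Fin m ⊕ Fin m) ℝ) :=
  {S | Sᵀ * Jsmall m * S = Jsmall m}

/-- Embedding of block indices `1..4` of sizes `k, m, k, m`. -/
def r1 (k m : ℕ) : Fin k → FullIdx k m := fun i => Sum.inl (Sum.inl i)
def r2 (k m : ℕ) : Fin m → FullIdx k m := fun i => Sum.inl (Sum.inr i)
def r3 (k m : ℕ) : Fin k → FullIdx k m := fun i => Sum.inr (Sum.inl i)
def r4 (k m : ℕ) : Fin m → FullIdx k m := fun i => Sum.inr (Sum.inr i)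

/-- Embedding of the indices `{k+1,…,ℓ} ∪ {ℓ+k+1,…,2ℓ}`. -/
def embSmall (k m : ℕ) : Fin m ⊕ Fin m → FullIdx k m :=
  Sum.elim (fun i => Sum.inl (Sum.inr i)) (fun i => Sum.inr (Sum.inr i))

/-- The upper-left `k × k` block `A₁`. -/
def blk1 (k m : ℕ) (M : Matrix (FullIdx k m) (FullIdx k m) ℝ) : Matrix (Fin k) (Fin k) ℝ :=
  M.submatrix (r1 k m) (r1 k m)

/-- The `2(ℓ-k) × 2(ℓ-k)` submatrix `A₂`. -/
def blk2 (k m : ℕ) (M : Matrix (FullIdx k m) (FullIdx k m) ℝ) :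
    Matrix (Fin m ⊕ Fin m) (Fin m ⊕ Fin m) ℝ :=
  M.submatrix (embSmall k m) (embSmall k m)

/-- `Sp(k,ℓ)`: symplectic matrices with `a_{ij} = 0` for `1 ≤ j ≤ k` and `i > k`. -/
def SpKL (k m : ℕ) : Set (Matrix (FullIdx k m) (FullIdx k m) ℝ) :=
  {M | M ∈ SpBig k m ∧
    ∀ (i : FullIdx k m) (j : Fin k), (∀ i' : Fin k, i ≠ r1 k m i') → M i (r1 k m j) = 0}

/-- The kernel `T` of `ϖ : Sp(k,ℓ) → GL(k,ℝ) × Sp(ℓ-k)`. -/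
def kerVarpi (k m : ℕ) : Set (Matrix (FullIdx k m) (FullIdx k m) ℝ) :=
  {M | M ∈ SpKL k m ∧ blk1 k m M = 1 ∧ blk2 k m M = 1}

/-- `Sp₊(k,ℓ)`: elements of `Sp(k,ℓ)` with `det A₁ > 0`. -/
def SpPlus (k m : ℕ) : Set (Matrix (FullIdx k m) (FullIdx k m) ℝ) :=
  {M | M ∈ SpKL k m ∧ 0 < (blk1 k m M).det}

/-- The kernel of `γ : Sp₊(k,ℓ) → Sp(ℓ-k)`, the second component of `ϖ`. -/
def kerGamma (k m : ℕ) : Set (Matrix (FullIdx k m) (FullIdx k m) ℝ) :=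
  {M | M ∈ SpPlus k m ∧ blk2 k m M = 1}

lemma SpKL_col_eq_zero {k m : ℕ} {M : Matrix (FullIdx k m) (FullIdx k m) ℝ} (hM : M ∈ SpKL k m)
    (j : Fin k) :
    (∀ i, M (Sum.inl (Sum.inr i)) (Sum.inl (Sum.inl j)) = 0) ∧
      ∀ i, M (Sum.inr i) (Sum.inl (Sum.inl j)) = 0 :=
  ⟨fun i => hM.2 (Sum.inl (Sum.inr i)) j (by simp [r1]),
    fun i => hM.2 (Sum.inr i) j (by simp [r1])⟩

lemma Jmat_mul_inl {k m : ℕ} (M : Matrix (FullIdx k m) (FullIdx k m) ℝ) (i : HalfIdx k m)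
    (x : FullIdx k m) : (Jmat k m * M) (Sum.inl i) x = M (Sum.inr i) x := by
  rw [Matrix.mul_apply, Fintype.sum_sum_type]
  simp [Jmat, Matrix.one_apply, -Fintype.sum_sum_type]

lemma SpKL_blk1_transpose_mul {k m : ℕ} {M : Matrix (FullIdx k m) (FullIdx k m) ℝ}
    (hM : M ∈ SpKL k m) :
    (blk1 k m M)ᵀ * M.submatrix (r3 k m) id = (Jmat k m).submatrix (r1 k m) id := by
  ext i x
  have h := congr_fun (congr_fun hM.1 (r1 k m i)) x
  rw [Matrix.mul_assoc, Matrix.mul_apply] at h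
  rw [Matrix.submatrix_apply, id, ← h]
  rw [Matrix.mul_apply]
  simp [blk1, r1, r3, (SpKL_col_eq_zero hM i).1,
    (SpKL_col_eq_zero hM i).2, Jmat_mul_inl]

lemma SpKL_row_eq_zero {k m : ℕ} {M : Matrix (FullIdx k m) (FullIdx k m) ℝ} (hM : M ∈ SpKL k m)
    (i : Fin k) (j : Fin m) :
    M (Sum.inr (Sum.inl i)) (Sum.inl (Sum.inr j)) = 0 ∧
      M (Sum.inr (Sum.inl i)) (Sum.inr (Sum.inr j)) = 0 := by
  have h := SpKL_blk1_transpose_mul hM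
  have hinv : (blk1 k m M)ᵀ * M.submatrix (r3 k m) (r3 k m) = 1 := by
    ext a b
    simpa [Matrix.mul_apply, Jmat, r1, r3, Matrix.one_apply] using
      congr_fun (congr_fun h a) (r3 k m b)
  have h' : M.submatrix (r3 k m) id =
      M.submatrix (r3 k m) (r3 k m) * (Jmat k m).submatrix (r1 k m) id := by
    rw [← h, ← Matrix.mul_assoc, mul_eq_one_comm.mp hinv, Matrix.one_mul]
  refine ⟨(congr_fun (congr_fun h' i) (Sum.inl (Sum.inr j))).trans ?_,
    (congr_fun (congr_fun h' i) (Sum.inr (Sum.inr j))).trans ?_⟩ <;>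
  simp [Matrix.mul_apply, Jmat, r1]

lemma kerVarpi_row_eq_one {k m : ℕ} {M : Matrix (FullIdx k m) (FullIdx k m) ℝ}
    (hM : M ∈ kerVarpi k m) (i j : Fin k) :
    M (Sum.inr (Sum.inl i)) (Sum.inr (Sum.inl j)) = if i = j then 1 else 0 := by
  have h := SpKL_blk1_transpose_mul hM.1
  rw [hM.2.1, Matrix.transpose_one, Matrix.one_mul] at h
  simpa [Jmat, r1, r3, Matrix.one_apply] using congr_fun (congr_fun h i) (r3 k m j)

lemma one_mem_SpKL (k m : ℕ) : (1 : Matrix (FullIdx k m) (FullIdx k m) ℝ) ∈ SpKL k m := by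
  refine ⟨by simp [SpBig], fun i j h => Matrix.one_apply_ne (h j)⟩

lemma blk1_one (k m : ℕ) : blk1 k m 1 = 1 :=
  Matrix.submatrix_one _ fun a b h => by simpa [r1] using h

lemma blk2_one (k m : ℕ) : blk2 k m 1 = 1 :=
  Matrix.submatrix_one _ (by rintro (a | a) (b | b) h <;> simp_all [embSmall])

lemma one_mem_kerVarpi (k m : ℕ) : (1 : Matrix (FullIdx k m) (FullIdx k m) ℝ) ∈ kerVarpi k m :=
  ⟨one_mem_SpKL k m, blk1_one k m, blk2_one k m⟩

lemma mul_mem_SpBig {k m : ℕ} {M N : Matrix (FullIdx k m) (FullIdx k m) ℝ}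
    (hM : M ∈ SpBig k m) (hN : N ∈ SpBig k m) : M * N ∈ SpBig k m := by
  have hM' : Mᵀ * Jmat k m * M = Jmat k m := hM
  have hN' : Nᵀ * Jmat k m * N = Jmat k m := hN
  calc (M * N)ᵀ * Jmat k m * (M * N) = Nᵀ * (Mᵀ * Jmat k m * M) * N := by
        simp only [Matrix.transpose_mul, Matrix.mul_assoc]
    _ = Jmat k m := by rw [hM', hN']

lemma mul_mem_SpKL {k m : ℕ} {M N : Matrix (FullIdx k m) (FullIdx k m) ℝ}
    (hM : M ∈ SpKL k m) (hN : N ∈ SpKL k m) : M * N ∈ SpKL k m := by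
  refine ⟨mul_mem_SpBig hM.1 hN.1, fun i j hi => ?_⟩
  have hi' : ∀ i', M i (Sum.inl (Sum.inl i')) = 0 := fun i' => hM.2 i i' hi
  simp [Matrix.mul_apply, r1, hi', (SpKL_col_eq_zero hN j).1, (SpKL_col_eq_zero hN j).2]

lemma blk1_mul {k m : ℕ} (M : Matrix (FullIdx k m) (FullIdx k m) ℝ)
    {N : Matrix (FullIdx k m) (FullIdx k m) ℝ} (hN : N ∈ SpKL k m) :
    blk1 k m (M * N) = blk1 k m M * blk1 k m N := by
  ext i j
  simp [blk1, Matrix.mul_apply, r1, (SpKL_col_eq_zero hN j).1, (SpKL_col_eq_zero hN j).2]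

lemma blk2_mul {k m : ℕ} {M N : Matrix (FullIdx k m) (FullIdx k m) ℝ}
    (hM : M ∈ SpKL k m) (hN : N ∈ SpKL k m) :
    blk2 k m (M * N) = blk2 k m M * blk2 k m N := by
  ext (i | i) (j | j) <;>
  simp [blk2, Matrix.mul_apply, embSmall, (SpKL_col_eq_zero hM _).1, (SpKL_col_eq_zero hM _).2,
    (SpKL_row_eq_zero hN _ _).1, (SpKL_row_eq_zero hN _ _).2]

lemma mul_mem_kerVarpi {k m : ℕ} {M N : Matrix (FullIdx k m) (FullIdx k m) ℝ}
    (hM : M ∈ kerVarpi k m) (hN : N ∈ kerVarpi k m) : M * N ∈ kerVarpi k m :=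
  ⟨mul_mem_SpKL hM.1 hN.1, by rw [blk1_mul M hN.1, hM.2.1, hN.2.1, one_mul],
    by rw [blk2_mul hM.1 hN.1, hM.2.2, hN.2.2, one_mul]⟩

lemma Jmat_mul_self (k m : ℕ) : Jmat k m * Jmat k m = -1 := by
  simp [Jmat, Matrix.fromBlocks_multiply, ← Matrix.fromBlocks_one, Matrix.fromBlocks_neg]

lemma exists_inv_of_mem_SpBig {k m : ℕ} {M : Matrix (FullIdx k m) (FullIdx k m) ℝ}
    (hM : M ∈ SpBig k m) : ∃ N ∈ SpBig k m, M * N = 1 ∧ N * M = 1 := by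
  have hM' : Mᵀ * Jmat k m * M = Jmat k m := hM
  have hNM : (-(Jmat k m * Mᵀ * Jmat k m)) * M = 1 := by
    rw [Matrix.neg_mul, Matrix.mul_assoc, Matrix.mul_assoc, ← Matrix.mul_assoc Mᵀ, hM',
      Jmat_mul_self, neg_neg]
  have hMN := mul_eq_one_comm.mp hNM
  set N := -(Jmat k m * Mᵀ * Jmat k m) with hN
  refine ⟨N, ?_, hMN, hNM⟩
  calc Nᵀ * Jmat k m * N = Nᵀ * (Mᵀ * Jmat k m * M) * N := by rw [hM']
    _ = (M * N)ᵀ * Jmat k m * (M * N) := by simp only [Matrix.transpose_mul, Matrix.mul_assoc]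
    _ = Jmat k m := by rw [hMN, Matrix.transpose_one, Matrix.one_mul, Matrix.mul_one]

lemma mulVec_single_of_mem_kerVarpi {k m : ℕ} {M : Matrix (FullIdx k m) (FullIdx k m) ℝ}
    (hM : M ∈ kerVarpi k m) (j : Fin k) :
    M *ᵥ Pi.single (r1 k m j) 1 = Pi.single (r1 k m j) 1 := by
  have h : ∀ i, M (Sum.inl (Sum.inl i)) (Sum.inl (Sum.inl j)) = if i = j then 1 else 0 :=
    fun i => by simpa [blk1, r1, Matrix.one_apply] using congr_fun (congr_fun hM.2.1 i) j
  ext ((i | i) | i) <;>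
  simp [r1, (SpKL_col_eq_zero hM.1 j).1, (SpKL_col_eq_zero hM.1 j).2, h, Pi.single_apply]

lemma exists_inv_of_mem_kerVarpi {k m : ℕ} {M : Matrix (FullIdx k m) (FullIdx k m) ℝ}
    (hM : M ∈ kerVarpi k m) : ∃ N ∈ kerVarpi k m, M * N = 1 ∧ N * M = 1 := by
  obtain ⟨N, hN, hMN, hNM⟩ := exists_inv_of_mem_SpBig hM.1.1
  have hcol (j : Fin k) : N *ᵥ Pi.single (r1 k m j) 1 = Pi.single (r1 k m j) 1 := by
    conv_lhs => rw [← mulVec_single_of_mem_kerVarpi hM j]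
    rw [Matrix.mulVec_mulVec, hNM, Matrix.one_mulVec]
  have hN' : N ∈ SpKL k m := by
    refine ⟨hN, fun i j hi => ?_⟩
    have h := congr_fun (hcol j) i
    rwa [Matrix.mulVec_single_one, Pi.single_eq_of_ne (hi j)] at h
  refine ⟨N, ⟨hN', ?_, ?_⟩, hMN, hNM⟩
  · rw [← blk1_one, ← hMN, blk1_mul M hN', hM.2.1, one_mul]
  · rw [← blk2_one, ← hMN, blk2_mul hM.1 hN', hM.2.2, one_mul]

lemma conj_mem_kerVarpi {k m : ℕ} {g g' t : Matrix (FullIdx k m) (FullIdx k m) ℝ}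
    (hg : g ∈ SpKL k m) (hg' : g' ∈ SpKL k m) (h : g * g' = 1) (ht : t ∈ kerVarpi k m) :
    g * t * g' ∈ kerVarpi k m := by
  refine ⟨mul_mem_SpKL (mul_mem_SpKL hg ht.1) hg', ?_, ?_⟩
  · rw [blk1_mul _ hg', blk1_mul _ ht.1, ht.2.1, mul_one, ← blk1_mul _ hg', h, blk1_one]
  · rw [blk2_mul (mul_mem_SpKL hg ht.1) hg', blk2_mul hg ht.1, ht.2.2, mul_one,
      ← blk2_mul hg hg', h, blk2_one]

/-- The weight of an index under the one-parameter group `diag(t², t, 1, t)`. -/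
def idxWeight (k m : ℕ) : FullIdx k m → ℕ :=
  Sum.elim (Sum.elim (fun _ => 2) fun _ => 1) (Sum.elim (fun _ => 0) fun _ => 1)

/-- The extension to `t = 0` of conjugation by `diag(t², t, 1, t)` on block-triangular matrices. -/
def weightScale (k m : ℕ) (t : ℝ) (M : Matrix (FullIdx k m) (FullIdx k m) ℝ) :
    Matrix (FullIdx k m) (FullIdx k m) ℝ :=
  Matrix.of fun i j => t ^ (idxWeight k m i - idxWeight k m j) * M i j

lemma kerVarpi_apply_eq_one {k m : ℕ} {M : Matrix (FullIdx k m) (FullIdx k m) ℝ}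
    (hM : M ∈ kerVarpi k m) {i j : FullIdx k m} (hij : idxWeight k m i ≤ idxWeight k m j) :
    M i j = (1 : Matrix (FullIdx k m) (FullIdx k m) ℝ) i j := by
  have h1 (a b) := congr_fun (congr_fun hM.2.1 a) b
  have h2 (a b) := congr_fun (congr_fun hM.2.2 a) b
  obtain (i | i) | (i | i) := i <;> obtain (j | j) | (j | j) := j <;>
    simp [idxWeight] at hij
  · simpa [blk1, r1, Matrix.one_apply] using h1 i j
  · simp [(SpKL_col_eq_zero hM.1 j).1]
  · simpa [blk2, embSmall, Matrix.one_apply] using h2 (Sum.inl i) (Sum.inl j)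
  · simpa [blk2, embSmall, Matrix.one_apply] using h2 (Sum.inl i) (Sum.inr j)
  · simp [(SpKL_col_eq_zero hM.1 j).2]
  · simp [(SpKL_row_eq_zero hM.1 i j).1]
  · simp [kerVarpi_row_eq_one hM, Matrix.one_apply]
  · simp [(SpKL_row_eq_zero hM.1 i j).2]
  · simp [(SpKL_col_eq_zero hM.1 j).2]
  · simpa [blk2, embSmall, Matrix.one_apply] using h2 (Sum.inr i) (Sum.inl j)
  · simpa [blk2, embSmall, Matrix.one_apply] using h2 (Sum.inr i) (Sum.inr j)

lemma weightScale_apply_of_le {k m : ℕ} {M : Matrix (FullIdx k m) (FullIdx k m) ℝ} (t : ℝ)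
    {i j : FullIdx k m} (hij : idxWeight k m i ≤ idxWeight k m j) :
    weightScale k m t M i j = M i j := by
  simp [weightScale, Nat.sub_eq_zero_of_le hij]

lemma weightScale_zero {k m : ℕ} {M : Matrix (FullIdx k m) (FullIdx k m) ℝ}
    (hM : M ∈ kerVarpi k m) : weightScale k m 0 M = 1 := by
  ext i j
  by_cases hij : idxWeight k m i ≤ idxWeight k m j
  · rw [weightScale_apply_of_le _ hij, kerVarpi_apply_eq_one hM hij]
  · have hne : i ≠ j := fun h => hij (h ▸ le_rfl)
    simp [weightScale, Matrix.one_apply_ne hne, Nat.sub_ne_zero_of_lt (not_le.mp hij)]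

lemma weightScale_one {k m : ℕ} (M : Matrix (FullIdx k m) (FullIdx k m) ℝ) :
    weightScale k m 1 M = M := by
  ext i j
  simp [weightScale]

lemma weightScale_mul_diagonal {k m : ℕ} {M : Matrix (FullIdx k m) (FullIdx k m) ℝ}
    (hM : M ∈ kerVarpi k m) (t : ℝ) :
    weightScale k m t M * Matrix.diagonal (fun i => t ^ idxWeight k m i) =
      Matrix.diagonal (fun i => t ^ idxWeight k m i) * M := by
  ext i j
  rw [Matrix.mul_diagonal, Matrix.diagonal_mul]
  by_cases hij : idxWeight k m i ≤ idxWeight k m j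
  · rw [weightScale_apply_of_le _ hij, kerVarpi_apply_eq_one hM hij]
    by_cases h : i = j
    · subst h; ring
    · simp [Matrix.one_apply_ne h]
  · rw [weightScale, Matrix.of_apply, mul_right_comm, ← pow_add, Nat.sub_add_cancel (by omega)]

lemma diagonal_mul_Jmat_mul_diagonal (k m : ℕ) (t : ℝ) :
    Matrix.diagonal (fun i => t ^ idxWeight k m i) * Jmat k m *
      Matrix.diagonal (fun i => t ^ idxWeight k m i) = t ^ 2 • Jmat k m := by
  ext ((i | i) | (i | i)) ((j | j) | (j | j)) <;>
  simp [Jmat, idxWeight, Matrix.one_apply, Matrix.mul_diagonal, Matrix.diagonal_mul] <;>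
  ring_nf

lemma weightScale_mem_SpBig {k m : ℕ} {M : Matrix (FullIdx k m) (FullIdx k m) ℝ}
    (hM : M ∈ kerVarpi k m) {t : ℝ} (ht : t ≠ 0) : weightScale k m t M ∈ SpBig k m := by
  have hM' : Mᵀ * Jmat k m * M = Jmat k m := hM.1.1
  have hD := weightScale_mul_diagonal hM t
  have hJ := diagonal_mul_Jmat_mul_diagonal k m t
  set D : Matrix (FullIdx k m) (FullIdx k m) ℝ := Matrix.diagonal fun i => t ^ idxWeight k m i
    with hDdef
  have hDt : Dᵀ = D := Matrix.diagonal_transpose _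
  have hDu : IsUnit D := by
    rw [Matrix.isUnit_iff_isUnit_det, hDdef, Matrix.det_diagonal, isUnit_iff_ne_zero]
    exact Finset.prod_ne_zero_iff.mpr fun i _ => pow_ne_zero _ ht
  set W := weightScale k m t M
  refine hDu.mul_left_cancel (hDu.mul_right_cancel ?_)
  calc D * (Wᵀ * Jmat k m * W) * D = (W * D)ᵀ * Jmat k m * (W * D) := by
        simp only [Matrix.transpose_mul, hDt, Matrix.mul_assoc]
    _ = Mᵀ * (D * Jmat k m * D) * M := by
        rw [hD]; simp only [Matrix.transpose_mul, hDt, Matrix.mul_assoc]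
    _ = D * Jmat k m * D := by
        rw [hJ, Matrix.mul_smul, Matrix.smul_mul, hM']

lemma weightScale_mem_kerVarpi {k m : ℕ} {M : Matrix (FullIdx k m) (FullIdx k m) ℝ}
    (hM : M ∈ kerVarpi k m) (t : ℝ) : weightScale k m t M ∈ kerVarpi k m := by
  rcases eq_or_ne t 0 with rfl | ht
  · rw [weightScale_zero hM]
    exact one_mem_kerVarpi k m
  refine ⟨⟨weightScale_mem_SpBig hM ht, fun i j hi => ?_⟩, ?_, ?_⟩
  · simp [weightScale, hM.1.2 i j hi]
  · rw [← hM.2.1]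
    ext i j
    exact weightScale_apply_of_le _ (by simp [r1, idxWeight])
  · rw [← hM.2.2]
    ext (i | i) (j | j) <;> exact weightScale_apply_of_le _ (by simp [embSmall, idxWeight])

lemma contractibleSpace_kerVarpi (k m : ℕ) : ContractibleSpace (kerVarpi k m) := by
  rw [contractible_iff_id_nullhomotopic]
  refine ⟨⟨1, one_mem_kerVarpi k m⟩, ContinuousMap.Homotopic.symm ⟨?_⟩⟩
  refine ⟨⟨fun p => ⟨weightScale k m p.1 p.2, weightScale_mem_kerVarpi p.2.2 p.1⟩, ?_⟩, ?_, ?_⟩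
  · refine Continuous.subtype_mk (continuous_matrix fun i j => ?_) _
    have h : Continuous fun p : unitInterval × kerVarpi k m => p.2.1 i j :=
      (continuous_subtype_val.comp continuous_snd).matrix_elem i j
    exact ((continuous_subtype_val.comp continuous_fst).pow _).mul h
  · exact fun M => Subtype.ext (weightScale_zero M.2)
  · exact fun M => Subtype.ext (weightScale_one M.1)

/-- `T = ker(ϖ)` is a normal subgroup of `Sp(k,ℓ)` which, with the
subspace topology from the `2ℓ × 2ℓ` real matrices, is contractible (hence simply
connected). -/
theorem stmt2 (k m : ℕ) (hk : 1 ≤ k) :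
    ((1 : Matrix (FullIdx k m) (FullIdx k m) ℝ) ∈ kerVarpi k m) ∧
    (∀ M ∈ kerVarpi k m, ∀ N ∈ kerVarpi k m, M * N ∈ kerVarpi k m) ∧
    (∀ M ∈ kerVarpi k m, ∃ N ∈ kerVarpi k m, M * N = 1 ∧ N * M = 1) ∧
    (∀ g ∈ SpKL k m, ∀ g' ∈ SpKL k m, g * g' = 1 → g' * g = 1 →
      ∀ t ∈ kerVarpi k m, g * t * g' ∈ kerVarpi k m) ∧
    ContractibleSpace ↥(kerVarpi k m) ∧ SimplyConnectedSpace ↥(kerVarpi k m) := by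
  have := contractibleSpace_kerVarpi k m
  exact ⟨one_mem_kerVarpi k m, fun M hM N hN => mul_mem_kerVarpi hM hN,
    fun M hM => exists_inv_of_mem_kerVarpi hM,
    fun g hg g' hg' h _ t ht => conj_mem_kerVarpi hg hg' h ht, this, inferInstance⟩
end

section
/- The intersection Sp₊(k,ℓ) ∩ u(U(ℓ)) equals {u(D(A,Z)) : A ∈ SO(k), Z ∈ U(ℓ−k)}, and this set is the connected component of the identity of the topological group U(k,ℓ) := Sp(k,ℓ) ∩ u(U(ℓ)) (with the subspace topology from the 2ℓ×2ℓ real matrices). -/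
open Matrix

/-- The standard embedding `u : U(ℓ) → Sp(ℓ)`, sending `X + iY` to `[[X,-Y],[Y,X]]`. -/
def uMap (k m : ℕ) (Z : Matrix (HalfIdx k m) (HalfIdx k m) ℂ) :
    Matrix (FullIdx k m) (FullIdx k m) ℝ :=
  Matrix.fromBlocks (Z.map Complex.re) (-(Z.map Complex.im))
    (Z.map Complex.im) (Z.map Complex.re)

/-- The block-diagonal complex matrix `D(A,Z)` with diagonal blocks `A` and `Z`. -/
def Dmat (k m : ℕ) (A : Matrix (Fin k) (Fin k) ℝ) (Z : Matrix (Fin m) (Fin m) ℂ) :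
    Matrix (HalfIdx k m) (HalfIdx k m) ℂ :=
  Matrix.fromBlocks (A.map fun x => (x : ℂ)) 0 0 Z

/-- `U(k,ℓ) = Sp(k,ℓ) ∩ u(U(ℓ))`. -/
def UKL (k m : ℕ) : Set (Matrix (FullIdx k m) (FullIdx k m) ℝ) :=
  {M | M ∈ SpKL k m ∧ ∃ Z ∈ Matrix.unitaryGroup (HalfIdx k m) ℂ, M = uMap k m Z}

/-- `{u(D(A,Z)) : A ∈ SO(k), Z ∈ U(ℓ-k)}`. -/
def SOUset (k m : ℕ) : Set (Matrix (FullIdx k m) (FullIdx k m) ℝ) :=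
  {M | ∃ A Z, A ∈ Matrix.orthogonalGroup (Fin k) ℝ ∧ A.det = 1 ∧
      Z ∈ Matrix.unitaryGroup (Fin m) ℂ ∧ M = uMap k m (Dmat k m A Z)}

section Orthogonal

variable {n : Type*} [Fintype n] [DecidableEq n]

/-- The matrix of the reflection in the hyperplane orthogonal to `v`. -/
noncomputable def householder (v : n → ℝ) : Matrix n n ℝ :=
  1 - (2 / (v ⬝ᵥ v)) • vecMulVec v v

theorem householder_neg (v : n → ℝ) : householder (-v) = householder v := by
  simp [householder, vecMulVec_neg, neg_vecMulVec]

theorem householder_transpose (v : n → ℝ) : (householder v)ᵀ = householder v := by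
  simp [householder, transpose_vecMulVec]

theorem householder_mul_self (v : n → ℝ) : householder v * householder v = 1 := by
  rcases eq_or_ne v 0 with rfl | hv
  · simp [householder]
  have h : v ⬝ᵥ v ≠ 0 := by simpa using hv
  have h2 : vecMulVec v v * vecMulVec v v = (v ⬝ᵥ v) • vecMulVec v v := by
    rw [vecMulVec_mul_vecMulVec, vecMulVec_smul]
  simp only [householder, sub_mul, mul_sub, one_mul, mul_one, Matrix.smul_mul, Matrix.mul_smul, h2,
    smul_smul]
  have : 2 / (v ⬝ᵥ v) * (2 / (v ⬝ᵥ v) * (v ⬝ᵥ v)) = 2 / (v ⬝ᵥ v) + 2 / (v ⬝ᵥ v) := by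
    field_simp; norm_num
  rw [this, add_smul]
  abel

theorem householder_mem_unitaryGroup (v : n → ℝ) : householder v ∈ unitaryGroup n ℝ := by
  rw [mem_unitaryGroup_iff, star_eq_conjTranspose, conjTranspose_eq_transpose_of_trivial,
    householder_transpose, householder_mul_self]

theorem det_householder {v : n → ℝ} (hv : v ≠ 0) : (householder v).det = -1 := by
  have h : v ⬝ᵥ v ≠ 0 := by simpa using hv
  have : householder v = 1 + vecMulVec (-(2 / (v ⬝ᵥ v)) • v) v := by
    rw [householder, smul_vecMulVec, neg_smul, sub_eq_add_neg]
  rw [this, vecMulVec_eq Unit, det_one_add_replicateCol_mul_replicateRow, dotProduct_smul,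
    smul_eq_mul]
  field_simp
  norm_num

theorem householder_mulVec (v x : n → ℝ) :
    householder v *ᵥ x = x - (2 * ((v ⬝ᵥ x) / (v ⬝ᵥ v))) • v := by
  ext i
  simp [householder, sub_mulVec, smul_mulVec, vecMulVec_mulVec]
  ring

/-- `householder v` as an element of the orthogonal group. -/
noncomputable def householderUnitary (v : n → ℝ) : unitaryGroup n ℝ :=
  ⟨householder v, householder_mem_unitaryGroup v⟩

theorem joined_householderUnitary_of_nonneg {v w : n → ℝ} (hv : v ≠ 0) (hw : w ≠ 0)
    (h : 0 ≤ v ⬝ᵥ w) : Joined (householderUnitary v) (householderUnitary w) := by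
  have hne (t : unitInterval) : (1 - (t : ℝ)) • v + (t : ℝ) • w ≠ 0 := by
    intro h0
    have hw' : 0 < w ⬝ᵥ w := by
      simpa using dotProduct_star_self_pos_iff.2 hw
    have h1 : (1 - (t : ℝ)) * (v ⬝ᵥ w) + t * (w ⬝ᵥ w) = 0 := by
      simpa [add_dotProduct] using congrArg (· ⬝ᵥ w) h0
    have ht : (t : ℝ) = 0 := by
      have h2 : 0 ≤ (1 - (t : ℝ)) * (v ⬝ᵥ w) := mul_nonneg (sub_nonneg.2 t.2.2) h
      have h3 : 0 ≤ (t : ℝ) * (w ⬝ᵥ w) := mul_nonneg t.2.1 hw'.le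
      have h4 : (t : ℝ) * (w ⬝ᵥ w) = 0 := by linarith
      simpa [hw'.ne'] using h4
    simp [ht, hv] at h0
  refine ⟨⟨⟨fun t => householderUnitary ((1 - (t : ℝ)) • v + (t : ℝ) • w), ?_⟩, ?_, ?_⟩⟩
  · refine Continuous.subtype_mk ?_ _
    unfold householder
    refine continuous_const.sub (Continuous.smul (f := fun t : unitInterval =>
      2 / (((1 - (t : ℝ)) • v + (t : ℝ) • w) ⬝ᵥ ((1 - (t : ℝ)) • v + (t : ℝ) • w)))
      (Continuous.div ?_ ?_ ?_) ?_)
    · fun_prop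
    · fun_prop
    · intro t
      exact dotProduct_self_eq_zero.not.2 (hne t)
    · fun_prop
  · simp
  · simp

theorem joined_householderUnitary {v w : n → ℝ} (hv : v ≠ 0) (hw : w ≠ 0) :
    Joined (householderUnitary v) (householderUnitary w) := by
  rcases le_total 0 (v ⬝ᵥ w) with h | h
  · exact joined_householderUnitary_of_nonneg hv hw h
  · have : householderUnitary v = householderUnitary (-v) :=
      Subtype.ext (householder_neg v).symm
    rw [this]
    exact joined_householderUnitary_of_nonneg (neg_ne_zero.2 hv) hw (by simpa using h)

theorem toEuclideanCLM_householder (v : EuclideanSpace ℝ n) :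
    toEuclideanCLM (𝕜 := ℝ) (householder v.ofLp) =
      ((ℝ ∙ v)ᗮ.reflection : EuclideanSpace ℝ n →L[ℝ] EuclideanSpace ℝ n) := by
  ext x i
  have h : ‖v‖ ^ 2 = v.ofLp ⬝ᵥ v.ofLp := by
    rw [← real_inner_self_eq_norm_sq, EuclideanSpace.inner_eq_star_dotProduct]; simp
  simp [householder_mulVec, Submodule.reflection_orthogonal_apply,
    Submodule.reflection_singleton_apply, h, EuclideanSpace.inner_eq_star_dotProduct,
    dotProduct_comm]
  ring

theorem exists_eq_prod_householderUnitary (A : unitaryGroup n ℝ) :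
    ∃ l : List (n → ℝ), A = (l.map householderUnitary).prod := by
  let Φ : Matrix n n ℝ →⋆* (EuclideanSpace ℝ n →L[ℝ] EuclideanSpace ℝ n) :=
    { toFun := toEuclideanCLM (𝕜 := ℝ) (n := n)
      map_one' := map_one _
      map_mul' := map_mul _
      map_star' := map_star _ }
  let F : unitaryGroup n ℝ →* (EuclideanSpace ℝ n ≃ₗᵢ[ℝ] EuclideanSpace ℝ n) :=
    Unitary.linearIsometryEquiv.toMonoidHom.comp (Unitary.map Φ).toMonoidHom
  have hF : Function.Injective F :=
    Unitary.linearIsometryEquiv.injective.comp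
      (Unitary.map_injective (toEuclideanCLM (𝕜 := ℝ) (n := n)).injective)
  obtain ⟨l, -, hl⟩ := (F A).reflections_generate_dim
  refine ⟨l.map WithLp.ofLp, hF ?_⟩
  rw [hl, map_list_prod, List.map_map, List.map_map]
  congr 2
  ext1 v
  refine LinearIsometryEquiv.ext fun x => ?_
  exact (DFunLike.congr_fun (toEuclideanCLM_householder v) x).symm

theorem joined_one_or_joined_householderUnitary {e : n → ℝ} (he : e ≠ 0) (A : unitaryGroup n ℝ) :
    Joined A 1 ∨ Joined A (householderUnitary e) := by
  obtain ⟨l, rfl⟩ := exists_eq_prod_householderUnitary A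
  have hee : householderUnitary e * householderUnitary e = 1 :=
    Subtype.ext (householder_mul_self e)
  induction l with
  | nil => exact Or.inl (Joined.refl _)
  | cons v l ih =>
    rw [List.map_cons, List.prod_cons]
    rcases eq_or_ne v 0 with rfl | hv
    · have : householderUnitary (0 : n → ℝ) = 1 :=
        Subtype.ext (by simp [householderUnitary, householder])
      rwa [this, one_mul]
    · have hj := joined_householderUnitary hv he
      rcases ih with ih | ih
      · exact Or.inr (by simpa using hj.mul ih)
      · exact Or.inl (by simpa [hee] using hj.mul ih)

theorem eq_of_sq_eq_one_of_mem_connectedComponent {X : Type*} [TopologicalSpace X]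
    {f : X → ℝ} (hf : Continuous f)
    (h : ∀ x, f x ^ 2 = 1) {x y : X} (hy : y ∈ connectedComponent x) : f y = f x := by
  have key := isPreconnected_connectedComponent (x := x).eq_one_or_eq_neg_one_of_sq_eq
    hf.continuousOn (fun z _ => h z)
  rcases key with h | h
  · exact (h hy).trans (h mem_connectedComponent).symm
  · exact (h hy).trans (h mem_connectedComponent).symm

theorem sq_det_of_mem_unitaryGroup {A : Matrix n n ℝ} (hA : A ∈ unitaryGroup n ℝ) :
    A.det ^ 2 = 1 := by
  have := congrArg det (mem_unitaryGroup_iff.1 hA)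
  simpa [star_eq_conjTranspose, sq] using this

theorem joined_one_of_det_eq_one {A : unitaryGroup n ℝ} (hA : (A : Matrix n n ℝ).det = 1) :
    Joined A 1 := by
  rcases isEmpty_or_nonempty n with hn | ⟨⟨i⟩⟩
  · rw [Subsingleton.elim A 1]
  have he : (Pi.single i 1 : n → ℝ) ≠ 0 := by simp
  refine (joined_one_or_joined_householderUnitary he A).resolve_right fun h => ?_
  have h1 : (householder (Pi.single i 1 : n → ℝ)).det = (A : Matrix n n ℝ).det :=
    eq_of_sq_eq_one_of_mem_connectedComponent (f := fun B : unitaryGroup n ℝ => (B : Matrix n n ℝ).det)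
      (continuous_subtype_val.matrix_det) (fun B => sq_det_of_mem_unitaryGroup B.2)
      (pathComponent_subset_component A h)
  rw [det_householder he, hA] at h1
  norm_num at h1

end Orthogonal

section Unitary

variable {n : Type*} [Fintype n] [DecidableEq n]

theorem Circle.exists_notMem_of_finite {s : Set Circle} (hs : s.Finite) : ∃ c, c ∉ s := by
  have : (Set.univ : Set Circle).Infinite :=
    isPreconnected_univ.infinite_of_nontrivial ⟨1, trivial, Circle.exp Real.pi, trivial, by
      intro h
      have := congrArg (fun c : Circle => (c : ℂ).re) h
      norm_num at this⟩
  obtain ⟨c, -, hc⟩ := this.exists_notMem_finite hs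
  exact ⟨c, hc⟩

open scoped Matrix.Norms.L2Operator in
theorem joined_one_of_neg_one_notMem_spectrum {U : unitaryGroup n ℂ}
    (hU : -1 ∉ spectrum ℂ (U : Matrix n n ℂ)) : Joined 1 U :=
  Unitary.joined 1 U ((Unitary.norm_sub_one_lt_two_iff U.2).2 hU)

/-- The scalar matrix of a complex number of modulus one, as a unitary matrix. -/
noncomputable def scalarUnitary (c : Circle) : unitaryGroup n ℂ :=
  ⟨(c : ℂ) • 1, by
    rw [mem_unitaryGroup_iff, star_smul, star_one, smul_mul_smul_comm, one_mul]
    simp [Complex.mul_conj]⟩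

theorem joined_one_unitaryGroup (U : unitaryGroup n ℂ) : Joined 1 U := by
  have hfin : (spectrum ℂ (U : Matrix n n ℂ)).Finite := Matrix.finite_spectrum _
  obtain ⟨c, hc⟩ := Circle.exists_notMem_of_finite
    (s := (fun c : Circle => -(c : ℂ)) ⁻¹' spectrum ℂ (U : Matrix n n ℂ))
    (hfin.preimage fun a _ b _ h => Circle.ext (neg_injective h))
  have h1 : Joined 1 (scalarUnitary c⁻¹ * U) := by
    apply joined_one_of_neg_one_notMem_spectrum
    intro h
    refine hc ((spectrum.smul_mem_smul_iff (r := Circle.toUnits c⁻¹)).1 ?_)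
    simpa [scalarUnitary, Units.smul_def] using h
  have h2 : Joined (scalarUnitary (n := n) 1) (scalarUnitary c) :=
    (PathConnectedSpace.joined 1 c).map (Continuous.subtype_mk (by fun_prop) _)
  have h3 : scalarUnitary (n := n) 1 = 1 := Subtype.ext (by simp [scalarUnitary])
  have h4 : scalarUnitary c * (scalarUnitary c⁻¹ * U) = U :=
    Subtype.ext (by simp [scalarUnitary, smul_smul])
  simpa [h3, h4] using h2.mul h1

end Unitary

section Symplectic

variable {k m : ℕ}

theorem uMap_mul (Z W : Matrix (HalfIdx k m) (HalfIdx k m) ℂ) :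
    uMap k m (Z * W) = uMap k m Z * uMap k m W := by
  rw [uMap, uMap, uMap, fromBlocks_multiply]
  congr 1 <;> ext i j <;>
    simp [mul_apply, Finset.sum_add_distrib, sub_eq_add_neg] <;> ring

theorem uMap_conjTranspose (Z : Matrix (HalfIdx k m) (HalfIdx k m) ℂ) :
    uMap k m Zᴴ = (uMap k m Z)ᵀ := by
  rw [uMap, uMap, fromBlocks_transpose]
  congr 1; ext i j; simp

theorem uMap_neg_I : uMap k m (-(Complex.I • 1)) = Jmat k m := by
  rw [uMap, Jmat]
  congr 1 <;> ext i j <;> by_cases h : i = j <;> simp [h, one_apply]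

theorem uMap_mem_SpBig {Z : Matrix (HalfIdx k m) (HalfIdx k m) ℂ}
    (hZ : Z ∈ unitaryGroup (HalfIdx k m) ℂ) : uMap k m Z ∈ SpBig k m := by
  have h : Zᴴ * Z = 1 := mem_unitaryGroup_iff'.1 hZ
  rw [SpBig, Set.mem_ofPred_eq, ← uMap_neg_I, ← uMap_conjTranspose, ← uMap_mul, ← uMap_mul]
  simp [h]

theorem blk1_uMap_Dmat (A : Matrix (Fin k) (Fin k) ℝ) (W : Matrix (Fin m) (Fin m) ℂ) :
    blk1 k m (uMap k m (Dmat k m A W)) = A := by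
  ext i j
  simp [blk1, r1, uMap, Dmat]

theorem Dmat_mem_unitaryGroup {A : Matrix (Fin k) (Fin k) ℝ} {W : Matrix (Fin m) (Fin m) ℂ}
    (hA : A ∈ orthogonalGroup (Fin k) ℝ) (hW : W ∈ unitaryGroup (Fin m) ℂ) :
    Dmat k m A W ∈ unitaryGroup (HalfIdx k m) ℂ := by
  have hA' : (A.map fun x => (x : ℂ)) * (A.map fun x => (x : ℂ))ᴴ = 1 := by
    have := congrArg (fun B => B.map Complex.ofRealHom) ((mem_orthogonalGroup_iff _ _).1 hA)
    simp only [Matrix.map_mul] at this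
    convert this using 1
    · congr 1; ext i j; simp
    · simp
  have hW' : W * Wᴴ = 1 := mem_unitaryGroup_iff.1 hW
  rw [mem_unitaryGroup_iff, star_eq_conjTranspose, Dmat, fromBlocks_conjTranspose,
    fromBlocks_multiply]
  simp [hA', hW']

theorem exists_eq_Dmat {Z : Matrix (HalfIdx k m) (HalfIdx k m) ℂ}
    (hZ : Z ∈ unitaryGroup (HalfIdx k m) ℂ) (h₁ : ∀ i j, (Z (Sum.inl i) (Sum.inl j)).im = 0)
    (h₂ : Z.toBlocks₂₁ = 0) :
    ∃ A ∈ orthogonalGroup (Fin k) ℝ, ∃ W ∈ unitaryGroup (Fin m) ℂ, Z = Dmat k m A W := by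
  let A : Matrix (Fin k) (Fin k) ℝ := Z.toBlocks₁₁.map Complex.re
  have hA : Z.toBlocks₁₁ = A.map Complex.ofRealHom := by
    ext i j
    exact Complex.ext (by simp [A]) (h₁ i j)
  have hAH : (A.map Complex.ofRealHom)ᴴ = Aᵀ.map Complex.ofRealHom := by ext i j; simp
  have hZ' := mem_unitaryGroup_iff'.1 hZ
  rw [star_eq_conjTranspose, ← fromBlocks_toBlocks Z, fromBlocks_conjTranspose,
    fromBlocks_multiply, h₂, hA, hAH, ← fromBlocks_one, fromBlocks_inj] at hZ'
  simp only [conjTranspose_zero, Matrix.mul_zero, Matrix.zero_mul, add_zero] at hZ'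
  obtain ⟨e₁, e₂, -, e₄⟩ := hZ'
  have hAA : Aᵀ * A = 1 := by
    rw [← Matrix.map_mul] at e₁
    refine map_injective Complex.ofRealHom.injective (e₁.trans ?_)
    simp
  have hAA' : A * Aᵀ = 1 := mul_eq_one_comm.1 hAA
  have h₁₂ : Z.toBlocks₁₂ = 0 := by
    have := congrArg (A.map Complex.ofRealHom * ·) e₂
    simpa [← Matrix.mul_assoc, ← Matrix.map_mul, hAA'] using this
  refine ⟨A, (mem_orthogonalGroup_iff' _ _).2 hAA, Z.toBlocks₂₂, ?_, ?_⟩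
  · rw [mem_unitaryGroup_iff', star_eq_conjTranspose]
    simpa [h₁₂] using e₄
  · conv_lhs => rw [← fromBlocks_toBlocks Z, h₂, h₁₂, hA]
    rfl

theorem mem_UKL_iff {M : Matrix (FullIdx k m) (FullIdx k m) ℝ} :
    M ∈ UKL k m ↔ ∃ A ∈ orthogonalGroup (Fin k) ℝ, ∃ W ∈ unitaryGroup (Fin m) ℂ,
      M = uMap k m (Dmat k m A W) := by
  constructor
  · rintro ⟨⟨-, h⟩, Z, hZ, rfl⟩
    obtain ⟨A, hA, W, hW, rfl⟩ := exists_eq_Dmat hZ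
      (fun i j => h (Sum.inr (Sum.inl i)) j (by simp [r1]))
      (by
        ext i j
        exact Complex.ext (h (Sum.inl (Sum.inr i)) j (by simp [r1]))
          (h (Sum.inr (Sum.inr i)) j (by simp [r1])))
    exact ⟨A, hA, W, hW, rfl⟩
  · rintro ⟨A, hA, W, hW, rfl⟩
    have hD := Dmat_mem_unitaryGroup hA hW
    refine ⟨⟨uMap_mem_SpBig hD, ?_⟩, _, hD, rfl⟩
    rintro ((i | i) | (i | i)) j hi
    · exact absurd rfl (hi i)
    all_goals simp [r1, uMap, Dmat]

theorem sq_det_blk1_of_mem_UKL {M : Matrix (FullIdx k m) (FullIdx k m) ℝ} (hM : M ∈ UKL k m) :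
    (blk1 k m M).det ^ 2 = 1 := by
  obtain ⟨A, hA, W, -, rfl⟩ := mem_UKL_iff.1 hM
  rw [blk1_uMap_Dmat]
  exact sq_det_of_mem_unitaryGroup hA

theorem mem_SOUset_iff {M : Matrix (FullIdx k m) (FullIdx k m) ℝ} :
    M ∈ SOUset k m ↔ M ∈ UKL k m ∧ (blk1 k m M).det = 1 := by
  rw [mem_UKL_iff]
  constructor
  · rintro ⟨A, W, hA, hdet, hW, rfl⟩
    exact ⟨⟨A, hA, W, hW, rfl⟩, by rwa [blk1_uMap_Dmat]⟩
  · rintro ⟨⟨A, hA, W, hW, rfl⟩, hdet⟩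
    exact ⟨A, W, hA, by rwa [blk1_uMap_Dmat] at hdet, hW, rfl⟩

/-- The map `(A, W) ↦ u(D(A, W))` from `O(k) × U(m)` to `U(k, k + m)`. -/
def toUKL (p : unitaryGroup (Fin k) ℝ × unitaryGroup (Fin m) ℂ) : UKL k m :=
  ⟨uMap k m (Dmat k m p.1 p.2), mem_UKL_iff.2 ⟨_, p.1.2, _, p.2.2, rfl⟩⟩

theorem continuous_toUKL : Continuous (toUKL (k := k) (m := m)) := by
  have hD : Continuous fun p : unitaryGroup (Fin k) ℝ × unitaryGroup (Fin m) ℂ =>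
      Dmat k m p.1 p.2 := by
    unfold Dmat
    fun_prop
  refine Continuous.subtype_mk ?_ _
  unfold uMap
  exact Continuous.matrix_fromBlocks (hD.matrix_map Complex.continuous_re)
    (hD.matrix_map Complex.continuous_im).neg (hD.matrix_map Complex.continuous_im)
    (hD.matrix_map Complex.continuous_re)

end Symplectic

/-- `Sp₊(k,ℓ) ∩ u(U(ℓ)) = {u(D(A,Z)) : A ∈ SO(k), Z ∈ U(ℓ-k)}`,
and this set is the identity component of `U(k,ℓ) = Sp(k,ℓ) ∩ u(U(ℓ))` with the
subspace topology. -/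
theorem stmt10 (k m : ℕ) (hk : 1 ≤ k) :
    ({M | M ∈ SpPlus k m ∧ ∃ Z ∈ Matrix.unitaryGroup (HalfIdx k m) ℂ, M = uMap k m Z}
      = SOUset k m) ∧
    (∀ h1 : (1 : Matrix (FullIdx k m) (FullIdx k m) ℝ) ∈ UKL k m,
      Subtype.val '' connectedComponent (⟨1, h1⟩ : ↥(UKL k m)) = SOUset k m) := by
  constructor
  · ext M
    rw [mem_SOUset_iff]
    constructor
    · rintro ⟨⟨hM, hpos⟩, hZ⟩
      have hU : M ∈ UKL k m := ⟨hM, hZ⟩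
      refine ⟨hU, (pow_eq_one_iff_of_nonneg hpos.le two_ne_zero).1 (sq_det_blk1_of_mem_UKL hU)⟩
    · rintro ⟨⟨hM, hZ⟩, hdet⟩
      exact ⟨⟨hM, by rw [hdet]; exact one_pos⟩, hZ⟩
  · intro h1
    ext M
    constructor
    · rintro ⟨x, hx, rfl⟩
      refine mem_SOUset_iff.2 ⟨x.2, ?_⟩
      have hcont : Continuous fun y : UKL k m => (blk1 k m y).det :=
        (continuous_subtype_val.matrix_submatrix _ _).matrix_det
      rw [eq_of_sq_eq_one_of_mem_connectedComponent hcont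
        (fun y => sq_det_blk1_of_mem_UKL y.2) hx]
      have : blk1 k m 1 = 1 := submatrix_one _ fun i j h => by simpa [r1] using h
      simp [this]
    · rintro ⟨A, W, hA, hdet, hW, rfl⟩
      have hj : Joined (1, 1) ((⟨A, hA⟩, ⟨W, hW⟩) :
          unitaryGroup (Fin k) ℝ × unitaryGroup (Fin m) ℂ) :=
        ⟨(joined_one_of_det_eq_one (A := ⟨A, hA⟩) hdet).symm.somePath.prod
          (joined_one_unitaryGroup ⟨W, hW⟩).somePath⟩
      have h1' : toUKL (1, 1) = (⟨1, h1⟩ : UKL k m) := by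
        refine Subtype.ext ?_
        have him : (1 : Matrix (HalfIdx k m) (HalfIdx k m) ℂ).map Complex.im = 0 := by
          ext i j
          by_cases h : i = j <;> simp [h]
        simp [toUKL, Dmat, uMap, him]
      have := hj.map continuous_toUKL
      rw [h1'] at this
      exact ⟨_, pathComponent_subset_component _ this, rfl⟩
end
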